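/- arXiv:2605.11586 — 2 statements merged into one kernel-verified Lean document; each statement's English description precedes it below -/
import Mathlib

section
/- Elliptical potential bound for episodic Gram matrices: Let d, K, H be positive integers and T = K·H, let φ : {1,…,K} × {1,…,H} → ℝ^d satisfy ‖φ(k,h)‖ ≤ 1 for all k, h, and define Σ_k = I + ∑_{τ=1}^{k-1} ∑_{h=1}^{H} φ(τ,h) φ(τ,h)ᵀ for k = 1, …, K+1. Then ∑_{k=1}^{K} ∑_{h=1}^{H} ‖φ(k,h)‖_{Σ_k⁻¹} ≤ 2·√(d·T·log(T+1)) + (3/2)·d·H·log(1 + T). -/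
open Finset Matrix

noncomputable section

theorem one_add_sum_le_prod_one_add_of_nonneg {ι : Type*} (s : Finset ι) (f : ι → ℝ)
    (hf : ∀ i ∈ s, 0 ≤ f i) : 1 + ∑ i ∈ s, f i ≤ ∏ i ∈ s, (1 + f i) := by
  classical
  induction s using Finset.induction_on with
  | empty => simp
  | insert a s ha ih =>
    rw [Finset.sum_insert ha, Finset.prod_insert ha]
    have h := ih fun i hi => hf i (Finset.mem_insert_of_mem hi)
    have h0 := hf a (Finset.mem_insert_self a s)
    have hs : 0 ≤ ∑ i ∈ s, f i :=
      Finset.sum_nonneg fun i hi => hf i (Finset.mem_insert_of_mem hi)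
    nlinarith [mul_nonneg h0 hs, mul_le_mul_of_nonneg_left h h0]

section DetOneAdd

variable {n : Type*} [Fintype n] [DecidableEq n] {A : Matrix n n ℝ}

theorem det_one_add_eq_prod_eigenvalues (hA : A.IsHermitian) :
    (1 + A).det = ∏ i, (1 + hA.eigenvalues i) := by
  have h1 : (1 + A) = -(Matrix.scalar n (-1 : ℝ) - A) := by
    rw [map_neg, map_one, neg_sub, sub_neg_eq_add, add_comm]
  rw [h1, Matrix.det_neg, ← Matrix.eval_charpoly, hA.charpoly_eq, Polynomial.eval_prod,
    ← Finset.card_univ, ← Finset.prod_const, ← Finset.prod_mul_distrib]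
  refine Finset.prod_congr rfl fun i _ => ?_
  simp
  ring

theorem one_add_trace_le_det_one_add (hA : A.PosSemidef) : 1 + A.trace ≤ (1 + A).det := by
  rw [det_one_add_eq_prod_eigenvalues hA.isHermitian, hA.isHermitian.trace_eq_sum_eigenvalues]
  exact one_add_sum_le_prod_one_add_of_nonneg _ _ fun i _ => hA.eigenvalues_nonneg i

theorem det_one_add_le_one_add_trace_pow (hA : A.PosSemidef) :
    (1 + A).det ≤ (1 + A.trace) ^ Fintype.card n := by
  rw [det_one_add_eq_prod_eigenvalues hA.isHermitian, hA.isHermitian.trace_eq_sum_eigenvalues,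
    ← Finset.card_univ, ← Finset.prod_const]
  refine Finset.prod_le_prod ?_ ?_
  · intro i _
    linarith [hA.eigenvalues_nonneg i]
  · intro i _
    have := Finset.single_le_sum (f := hA.isHermitian.eigenvalues)
      (fun j _ => hA.eigenvalues_nonneg j) (Finset.mem_univ i)
    simpa using this

/-- The determinant grows at least by the factor `1 + ∑ ‖v j‖²_{Σ⁻¹}` under the update
`Σ ↦ Σ + ∑ v j (v j)ᵀ`. -/
theorem det_mul_one_add_sum_le_det_add_sum_vecMulVec {ι : Type*} [Fintype ι]
    (hA : A.PosDef) (v : ι → n → ℝ) :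
    A.det * (1 + ∑ j, v j ⬝ᵥ (A⁻¹ *ᵥ v j)) ≤ (A + ∑ j, vecMulVec (v j) (v j)).det := by
  classical
  set U : Matrix n ι ℝ := (Matrix.of v)ᵀ with hU
  have hsum : ∑ j, vecMulVec (v j) (v j) = U * Uᵀ := by
    ext a b
    simp [hU, Matrix.sum_apply, Matrix.mul_apply, vecMulVec_apply]
  have hpsd : (Uᵀ * A⁻¹ * U).PosSemidef := by
    simpa [Matrix.conjTranspose_eq_transpose_of_trivial] using
      hA.inv.posSemidef.conjTranspose_mul_mul_same U
  have htr : (Uᵀ * A⁻¹ * U).trace = ∑ j, v j ⬝ᵥ (A⁻¹ *ᵥ v j) := by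
    refine Finset.sum_congr rfl fun j _ => ?_
    rw [Matrix.diag_apply, Matrix.mul_assoc, Matrix.mul_apply]
    rfl
  rw [hsum, Matrix.det_add_mul U Uᵀ ((Matrix.isUnit_iff_isUnit_det A).1 hA.isUnit), ← htr]
  exact mul_le_mul_of_nonneg_left (one_add_trace_le_det_one_add hpsd) hA.det_pos.le

theorem dotProduct_inv_one_add_mulVec_le (hA : A.PosSemidef) (x : n → ℝ) :
    x ⬝ᵥ ((1 + A)⁻¹ *ᵥ x) ≤ x ⬝ᵥ x := by
  have hdet : IsUnit (1 + A).det :=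
    (Matrix.isUnit_iff_isUnit_det _).1 (Matrix.PosDef.one.add_posSemidef hA).isUnit
  set y := (1 + A)⁻¹ *ᵥ x with hy
  have hx : x = y + A *ᵥ y := by
    have h : (1 + A) *ᵥ y = x := by
      rw [hy, Matrix.mulVec_mulVec, Matrix.mul_nonsing_inv _ hdet, Matrix.one_mulVec]
    rw [← h, Matrix.add_mulVec, Matrix.one_mulVec]
  have h1 : 0 ≤ y ⬝ᵥ (A *ᵥ y) := by simpa using hA.dotProduct_mulVec_nonneg y
  have h2 : 0 ≤ (A *ᵥ y) ⬝ᵥ (A *ᵥ y) := by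
    simpa using dotProduct_star_self_nonneg (A *ᵥ y)
  have h3 : (A *ᵥ y) ⬝ᵥ y = y ⬝ᵥ (A *ᵥ y) := dotProduct_comm _ _
  rw [hx]
  simp only [add_dotProduct, dotProduct_add, h3]
  linarith

end DetOneAdd

/-- If the `q h ∈ [0, 1]` satisfy `log (1 + ∑ q h) ≤ ℓ`, then their square roots sum to at most
`2 √(H ℓ) + (3/2) H ℓ`. -/
theorem sum_sqrt_le_of_log_one_add_sum_le {H : ℕ} {q : ℕ → ℝ} {l : ℝ}
    (hq0 : ∀ h < H, 0 ≤ q h) (hq1 : ∀ h < H, q h ≤ 1)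
    (hl : Real.log (1 + ∑ h ∈ Finset.range H, q h) ≤ l) :
    ∑ h ∈ Finset.range H, √(q h) ≤ 2 * (√H * √l) + 3 / 2 * H * l := by
  set S := ∑ h ∈ Finset.range H, q h with hS
  have hS0 : 0 ≤ S := Finset.sum_nonneg fun h hh => hq0 h (Finset.mem_range.1 hh)
  have hl0 : 0 ≤ l := (Real.log_nonneg (by linarith)).trans hl
  rcases le_total S 3 with h3 | h3
  · have hlog : S ≤ 4 * l := by
      have h1 := Real.one_sub_inv_le_log_of_pos (show 0 < 1 + S by linarith)
      have h2 : S / 4 ≤ 1 - (1 + S)⁻¹ := by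
        have h4 : 1 - (1 + S)⁻¹ = S / (1 + S) := by field_simp; ring
        rw [h4]
        exact div_le_div_of_nonneg_left hS0 (by linarith) (by linarith)
      linarith
    have hcs : ∑ h ∈ Finset.range H, √(q h) ≤ √H * √S := by
      rw [← Real.sqrt_mul (Nat.cast_nonneg H)]
      refine Real.le_sqrt_of_sq_le (sq_sum_le_card_mul_sum_sq.trans_eq ?_)
      rw [Finset.card_range, hS]
      congr 1
      exact Finset.sum_congr rfl fun h hh => Real.sq_sqrt (hq0 h (Finset.mem_range.1 hh))
    have hsq : √S ≤ 2 * √l := by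
      rw [Real.sqrt_le_left (by positivity), mul_pow, Real.sq_sqrt hl0]
      linarith
    have := mul_le_mul_of_nonneg_left hsq (Real.sqrt_nonneg (H : ℝ))
    have : 0 ≤ 3 / 2 * (H : ℝ) * l := by positivity
    linarith
  · have hlog : 3 / 4 ≤ l := by
      have h1 := Real.one_sub_inv_le_log_of_pos (show 0 < 1 + S by linarith)
      have h2 : (1 + S)⁻¹ ≤ (4 : ℝ)⁻¹ := inv_anti₀ (by norm_num) (by linarith)
      norm_num at h2
      linarith
    have hcard : ∑ h ∈ Finset.range H, √(q h) ≤ H := by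
      refine (Finset.sum_le_card_nsmul _ _ 1 fun h hh => ?_).trans_eq (by simp)
      exact Real.sqrt_le_one.2 (hq1 h (Finset.mem_range.1 hh))
    have : 0 ≤ 2 * (√(H : ℝ) * √l) := by positivity
    have : (H : ℝ) * (3 / 4) ≤ H * l := mul_le_mul_of_nonneg_left hlog (Nat.cast_nonneg H)
    have : (0 : ℝ) ≤ H := Nat.cast_nonneg H
    linarith

/-- **Elliptical potential bound for episodic Gram matrices.** With
`Σ_k = I + ∑_{τ<k} ∑_{h<H} φ(τ,h) φ(τ,h)ᵀ` and unit-norm-bounded features,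
`∑_{k=1}^K ∑_{h=1}^H ‖φ(k,h)‖_{Σ_k⁻¹} ≤ 2 √(d T log(T+1)) + (3/2) d H log(1+T)`
where `T = K·H`. -/
theorem episodic_elliptical_potential
    (d K H : ℕ) (hd : 0 < d) (hK : 0 < K) (hH : 0 < H)
    (φ : ℕ → ℕ → (Fin d → ℝ))
    (hφ : ∀ k < K, ∀ h < H, ∑ i, (φ k h i) ^ 2 ≤ 1)
    (Sig : ℕ → Matrix (Fin d) (Fin d) ℝ)
    (hSig : ∀ k, Sig k = 1 + ∑ τ ∈ Finset.range k, ∑ h ∈ Finset.range H,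
      vecMulVec (φ τ h) (φ τ h)) :
    ∑ k ∈ Finset.range K, ∑ h ∈ Finset.range H,
        Real.sqrt (φ k h ⬝ᵥ ((Sig k)⁻¹ *ᵥ φ k h))
      ≤ 2 * Real.sqrt ((d : ℝ) * ((K * H : ℕ) : ℝ) * Real.log (((K * H : ℕ) : ℝ) + 1))
        + (3 / 2) * (d : ℝ) * (H : ℝ) * Real.log (1 + ((K * H : ℕ) : ℝ)) := by
  set G : ℕ → Matrix (Fin d) (Fin d) ℝ := fun k =>
    ∑ τ ∈ Finset.range k, ∑ h ∈ Finset.range H, vecMulVec (φ τ h) (φ τ h) with hG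
  have hGpsd : ∀ k, (G k).PosSemidef := fun k =>
    posSemidef_sum _ fun τ _ => posSemidef_sum _ fun h _ => by
      simpa using posSemidef_vecMulVec_self_star (φ τ h)
  have hSG : ∀ k, Sig k = 1 + G k := hSig
  have hpd : ∀ k, (Sig k).PosDef := fun k => by
    rw [hSG]
    exact Matrix.PosDef.one.add_posSemidef (hGpsd k)
  have hunit : ∀ k < K, ∀ h < H, φ k h ⬝ᵥ φ k h ≤ 1 := fun k hk h hh => by
    simpa [dotProduct, pow_two] using hφ k hk h hh
  set q : ℕ → ℕ → ℝ := fun k h => φ k h ⬝ᵥ ((Sig k)⁻¹ *ᵥ φ k h) with hq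
  have hq0 : ∀ k h, 0 ≤ q k h := fun k h => by
    simpa using (hpd k).inv.posSemidef.dotProduct_mulVec_nonneg (φ k h)
  have hq1 : ∀ k < K, ∀ h < H, q k h ≤ 1 := fun k hk h hh => by
    refine le_trans ?_ (hunit k hk h hh)
    simp only [hq, hSG]
    exact dotProduct_inv_one_add_mulVec_le (hGpsd k) _
  set l : ℕ → ℝ := fun k => Real.log (Sig (k + 1)).det - Real.log (Sig k).det with hldef
  have hlog : ∀ k, Real.log (1 + ∑ h ∈ Finset.range H, q k h) ≤ l k := fun k => by
    have hpos : 0 < 1 + ∑ h ∈ Finset.range H, q k h := by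
      have := Finset.sum_nonneg fun h (_ : h ∈ Finset.range H) => hq0 k h
      linarith
    have hstep : Sig (k + 1) = Sig k + ∑ j : Fin H, vecMulVec (φ k j) (φ k j) := by
      rw [hSig, hSig, Finset.sum_range_succ, add_assoc,
        Finset.sum_range fun h => vecMulVec (φ k h) (φ k h)]
    have hdet := det_mul_one_add_sum_le_det_add_sum_vecMulVec (hpd k) fun j : Fin H => φ k j
    rw [← hstep, ← Finset.sum_range fun h => φ k h ⬝ᵥ ((Sig k)⁻¹ *ᵥ φ k h)] at hdet
    have := Real.log_le_log (mul_pos (hpd k).det_pos hpos) hdet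
    rw [Real.log_mul (hpd k).det_pos.ne' hpos.ne'] at this
    simp only [hldef]
    linarith
  have hl0 : ∀ k, 0 ≤ l k := fun k =>
    (Real.log_nonneg (by
      have := Finset.sum_nonneg fun h (_ : h ∈ Finset.range H) => hq0 k h
      linarith)).trans (hlog k)
  have htrace : (G K).trace ≤ ((K * H : ℕ) : ℝ) := by
    simp only [hG, Matrix.trace_sum, Matrix.trace_vecMulVec]
    calc ∑ k ∈ Finset.range K, ∑ h ∈ Finset.range H, φ k h ⬝ᵥ φ k h
        ≤ ∑ k ∈ Finset.range K, ∑ h ∈ Finset.range H, (1 : ℝ) :=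
          Finset.sum_le_sum fun k hk => Finset.sum_le_sum fun h hh =>
            hunit k (Finset.mem_range.1 hk) h (Finset.mem_range.1 hh)
      _ = ((K * H : ℕ) : ℝ) := by simp
  have hsuml : ∑ k ∈ Finset.range K, l k ≤ d * Real.log (1 + ((K * H : ℕ) : ℝ)) := by
    have hone : Sig 0 = 1 := by simp [hSig]
    rw [Finset.sum_range_sub fun k => Real.log (Sig k).det, hone, Matrix.det_one, Real.log_one,
      sub_zero, ← Real.log_pow]
    refine Real.log_le_log (hpd K).det_pos ?_
    rw [hSG]
    refine (det_one_add_le_one_add_trace_pow (hGpsd K)).trans ?_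
    rw [Fintype.card_fin]
    have := (hGpsd K).trace_nonneg
    gcongr
  have hcs : ∑ k ∈ Finset.range K, √(l k) ≤ √K * √(d * Real.log (1 + ((K * H : ℕ) : ℝ))) := by
    rw [← Real.sqrt_mul (Nat.cast_nonneg K)]
    refine Real.le_sqrt_of_sq_le (sq_sum_le_card_mul_sum_sq.trans ?_)
    rw [Finset.card_range]
    simp only [Real.sq_sqrt (hl0 _)]
    gcongr
  calc ∑ k ∈ Finset.range K, ∑ h ∈ Finset.range H, √(q k h)
      ≤ ∑ k ∈ Finset.range K, (2 * (√H * √(l k)) + 3 / 2 * H * l k) :=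
        Finset.sum_le_sum fun k hk => sum_sqrt_le_of_log_one_add_sum_le
          (fun h _ => hq0 k h) (hq1 k (Finset.mem_range.1 hk)) (hlog k)
    _ = 2 * (√H * ∑ k ∈ Finset.range K, √(l k)) + 3 / 2 * H * ∑ k ∈ Finset.range K, l k := by
        rw [Finset.sum_add_distrib, Finset.mul_sum, Finset.mul_sum, Finset.mul_sum]
    _ ≤ 2 * (√H * (√K * √(d * Real.log (1 + ((K * H : ℕ) : ℝ)))))
          + 3 / 2 * H * (d * Real.log (1 + ((K * H : ℕ) : ℝ))) := by gcongr
    _ = _ := by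
        rw [← Real.sqrt_mul (Nat.cast_nonneg K), ← Real.sqrt_mul (Nat.cast_nonneg H),
          add_comm ((K * H : ℕ) : ℝ) 1]
        push_cast
        ring_nf
end
end

section
/- A weakly communicating average-reward CMDP need not admit an optimal stationary policy: Let S = {s₁, s₂}, A = {a₁, a₂}, and let P be the deterministic transition kernel with P(s₁ | s₁, a₁) = 1, P(s₂ | s₁, a₂) = 1, P(s₁ | s₂, a₁) = 1, P(s₂ | s₂, a₂) = 1. Let r(s, a) = 1 if (s, a) = (s₂, a₂) and 0 otherwise, let g(s, a) = 1 if (s, a) = (s₁, a₁) and 0 otherwise, and let b = 1/2, with initial state s₁. Then: (1) the MDP (S, A, P) is weakly communicating; (2) sup { r·q : q ∈ Q(s₁), g·q ≥ 1/2 } = 1/2; and (3) there is no q ∈ Q(s₁) with g·q ≥ 1/2 and r·q = 1/2, i.e., the supremum is not attained by any stationary policy. -/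
open Finset Filter Topology

noncomputable section

/-- `P` is a transition kernel: nonnegative and each row sums to one. -/
def IsKernel {S A : Type*} [Fintype S] (P : S → A → S → ℝ) : Prop :=
  (∀ s a s', 0 ≤ P s a s') ∧ ∀ s a, ∑ s', P s a s' = 1

/-- `π` is a stationary randomized policy. -/
def IsPolicy {S A : Type*} [Fintype A] (π : S → A → ℝ) : Prop :=
  (∀ s a, 0 ≤ π s a) ∧ ∀ s, ∑ a, π s a = 1

/-- The Markov matrix induced by policy `π` on kernel `P`. -/
def markovMatrix {S A : Type*} [Fintype A] (P : S → A → S → ℝ) (π : S → A → ℝ) :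
    Matrix S S ℝ :=
  fun s s' => ∑ a, π s a * P s a s'

/-- `C` is closed under the Markov matrix `M`. -/
def IsClosedClass {S : Type*} (M : Matrix S S ℝ) (C : Set S) : Prop :=
  ∀ s ∈ C, ∀ s' ∉ C, M s s' = 0

/-- `C` is irreducible under the Markov matrix `M`. -/
def IsIrreducibleOn {S : Type*} [Fintype S] [DecidableEq S] (M : Matrix S S ℝ)
    (C : Set S) : Prop :=
  ∀ s ∈ C, ∀ s' ∈ C, ∃ n : ℕ, 0 < (M ^ n) s s'

/-- `s` is a transient state under the Markov matrix `M`. -/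
def IsTransient {S : Type*} [Fintype S] [DecidableEq S] (M : Matrix S S ℝ) (s : S) : Prop :=
  Summable fun n : ℕ => (M ^ (n + 1)) s s

/-- The MDP `(S, A, P)` is weakly communicating. -/
def WeaklyCommunicating {S A : Type*} [Fintype S] [DecidableEq S] [Fintype A]
    (P : S → A → S → ℝ) : Prop :=
  ∃ (π : S → A → ℝ) (C : Set S), IsPolicy π ∧ C.Nonempty ∧
    IsClosedClass (markovMatrix P π) C ∧ IsIrreducibleOn (markovMatrix P π) C ∧
    ∀ s ∉ C, ∀ π' : S → A → ℝ, IsPolicy π' → IsTransient (markovMatrix P π') s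

/-- `q` is the occupation measure of the policy `π` from initial state `s₁`:
the Cesàro averages `(1/T) ∑_{t=1}^T (P_π^{t-1})(s₁,s) ⬝ π s a` converge to `q (s,a)`. -/
def IsOccupation {S A : Type*} [Fintype S] [DecidableEq S] [Fintype A]
    (P : S → A → S → ℝ) (π : S → A → ℝ) (s₁ : S) (q : S × A → ℝ) : Prop :=
  ∀ s a, Tendsto
    (fun T : ℕ => (1 / (T : ℝ)) * ∑ t ∈ Finset.range T, ((markovMatrix P π) ^ t) s₁ s * π s a)
    atTop (𝓝 (q (s, a)))

/-- `Q(s₁)`: the set of occupation measures of stationary policies from `s₁`. -/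
def occSet {S A : Type*} [Fintype S] [DecidableEq S] [Fintype A]
    (P : S → A → S → ℝ) (s₁ : S) : Set (S × A → ℝ) :=
  {q | ∃ π : S → A → ℝ, IsPolicy π ∧ IsOccupation P π s₁ q}

/-- `c·q = ∑_{(s,a)} c(s,a) q(s,a)`. -/
def dotSA {S A : Type*} [Fintype S] [Fintype A] (c q : S × A → ℝ) : ℝ :=
  ∑ p, c p * q p

/-- The dual function `D(λ) = sup { r·q + λ(g·q − b) : q ∈ Q(s₁) }`. -/
def dualFn {S A : Type*} [Fintype S] [DecidableEq S] [Fintype A]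
    (P : S → A → S → ℝ) (s₁ : S) (r g : S × A → ℝ) (b : ℝ) (lam : ℝ) : ℝ :=
  sSup {x | ∃ q ∈ occSet P s₁, x = dotSA r q + lam * (dotSA g q - b)}

/-- The flow polytope `𝓟`. -/
def flowPolytope {S A : Type*} [Fintype S] [Fintype A] (P : S → A → S → ℝ) :
    Set (S × A → ℝ) :=
  {q | (∀ p, 0 ≤ q p) ∧ (∑ p, q p = 1) ∧
    ∀ s, ∑ a, q (s, a) = ∑ p : S × A, P p.1 p.2 s * q p}

/-- The deterministic kernel on `S = A = Fin 2`: taking action `a` moves to state `a`.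
In particular `P(s₁|s₁,a₁) = P(s₂|s₁,a₂) = P(s₁|s₂,a₁) = P(s₂|s₂,a₂) = 1`. -/
def exKernel : Fin 2 → Fin 2 → Fin 2 → ℝ := fun _ a s' => if s' = a then 1 else 0

/-- Reward: `r(s₂,a₂) = 1`, otherwise `0`. -/
def exReward : Fin 2 × Fin 2 → ℝ := fun p => if p = (1, 1) then 1 else 0

/-- Constraint: `g(s₁,a₁) = 1`, otherwise `0`. -/
def exConstraint : Fin 2 × Fin 2 → ℝ := fun p => if p = (0, 0) then 1 else 0
section Occupation

variable {S A : Type*} [Fintype S] [DecidableEq S] [Fintype A]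
  {P : S → A → S → ℝ} {π : S → A → ℝ} {s₁ : S} {q : S × A → ℝ}

lemma markovMatrix_mem_rowStochastic (hP : IsKernel P) (hπ : IsPolicy π) :
    markovMatrix P π ∈ Matrix.rowStochastic ℝ S := by
  refine Matrix.mem_rowStochastic_iff_sum.2
    ⟨fun s s' => sum_nonneg fun a _ => mul_nonneg (hπ.1 s a) (hP.1 s a s'), fun s => ?_⟩
  simp only [markovMatrix]
  rw [sum_comm]
  simp_rw [← mul_sum, hP.2, mul_one, hπ.2]

lemma IsOccupation.nonneg (hP : IsKernel P) (hπ : IsPolicy π) (h : IsOccupation P π s₁ q)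
    (p : S × A) : 0 ≤ q p := by
  refine ge_of_tendsto' (h p.1 p.2) fun T => mul_nonneg (by positivity) ?_
  exact sum_nonneg fun t _ => mul_nonneg
    ((pow_mem (markovMatrix_mem_rowStochastic hP hπ) t).1 _ _) (hπ.1 _ _)

lemma IsOccupation.sum_eq_one (hP : IsKernel P) (hπ : IsPolicy π)
    (h : IsOccupation P π s₁ q) : ∑ p, q p = 1 := by
  have hlim := tendsto_finsetSum univ fun (p : S × A) _ => h p.1 p.2
  refine tendsto_nhds_unique hlim (tendsto_const_nhds.congr' ?_)
  filter_upwards [eventually_ne_atTop 0] with T hT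
  rw [← mul_sum, sum_comm]
  have hrow (t : ℕ) : ∑ p : S × A, (markovMatrix P π ^ t) s₁ p.1 * π p.1 p.2 = 1 := by
    rw [Fintype.sum_prod_type]
    simp_rw [← mul_sum, hπ.2, mul_one]
    exact Matrix.sum_row_of_mem_rowStochastic
      (pow_mem (markovMatrix_mem_rowStochastic hP hπ) t) s₁
  simp [hrow, hT]

/-- At each state, an occupation measure is proportional to the policy. -/
lemma IsOccupation.mul_policy_comm (h : IsOccupation P π s₁ q) (s : S) (a a' : A) :
    q (s, a) * π s a' = q (s, a') * π s a := by
  refine tendsto_nhds_unique ((h s a).mul_const _) (((h s a').mul_const _).congr fun T => ?_)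
  simp_rw [← sum_mul]
  ring

lemma isOccupation_of_tendsto {m : S → ℝ}
    (h : ∀ s, Tendsto (fun t : ℕ => (markovMatrix P π ^ t) s₁ s) atTop (𝓝 (m s))) :
    IsOccupation P π s₁ fun p => m p.1 * π p.1 p.2 := fun s a => by
  simpa only [one_div] using ((h s).mul_const (π s a)).cesaro

end Occupation

lemma isKernel_exKernel : IsKernel exKernel :=
  ⟨fun s a s' => by unfold exKernel; split_ifs <;> norm_num, fun s a => by simp [exKernel]⟩

lemma markovMatrix_exKernel (π : Fin 2 → Fin 2 → ℝ) (s s' : Fin 2) :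
    markovMatrix exKernel π s s' = π s s' := by
  simp [markovMatrix, exKernel]

lemma dotSA_exReward (q : Fin 2 × Fin 2 → ℝ) : dotSA exReward q = q (1, 1) := by
  simp [dotSA, exReward]

lemma dotSA_exConstraint (q : Fin 2 × Fin 2 → ℝ) : dotSA exConstraint q = q (0, 0) := by
  simp [dotSA, exConstraint]

lemma weaklyCommunicating_exKernel : WeaklyCommunicating exKernel := by
  refine ⟨fun _ _ => 1 / 2, Set.univ, ⟨fun _ _ => by norm_num, fun _ => by simp⟩,
    Set.univ_nonempty, fun _ _ s' hs' => absurd (Set.mem_univ s') hs',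
    fun s _ s' _ => ⟨1, ?_⟩, fun s hs => absurd (Set.mem_univ s) hs⟩
  rw [pow_one, markovMatrix_exKernel]
  norm_num

/-- The policy switching from `s₁` with probability `x` and from `s₂` with probability `y`. -/
def switchPolicy (x y : ℝ) : Fin 2 → Fin 2 → ℝ := ![![1 - x, x], ![y, 1 - y]]

lemma isPolicy_switchPolicy {x y : ℝ} (hx : 0 ≤ x) (hx1 : x ≤ 1) (hy : 0 ≤ y) (hy1 : y ≤ 1) :
    IsPolicy (switchPolicy x y) := by
  constructor
  · intro s a
    fin_cases s <;> fin_cases a <;> simp [switchPolicy, *]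
  · intro s
    fin_cases s <;> simp [switchPolicy]

lemma markovMatrix_switchPolicy_pow {x y : ℝ} (hxy : x + y ≠ 0) (t : ℕ) :
    (markovMatrix exKernel (switchPolicy x y) ^ t) 0 =
      ![(y + x * (1 - x - y) ^ t) / (x + y), (x - x * (1 - x - y) ^ t) / (x + y)] := by
  induction t with
  | zero =>
    ext s
    fin_cases s
    · simp [add_comm y x, hxy]
    · simp
  | succ t ih =>
    ext s
    rw [pow_succ, Matrix.mul_apply, Fin.sum_univ_two, ih, markovMatrix_exKernel, markovMatrix_exKernel]
    fin_cases s <;> simp [switchPolicy] <;> field_simp <;> ring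

/-- The occupation measure is the stationary distribution times the policy. -/
lemma isOccupation_switchPolicy {x y : ℝ} (hxy : 0 < x + y) (hxy2 : x + y < 2) :
    IsOccupation exKernel (switchPolicy x y) 0
      fun p => ![y / (x + y), x / (x + y)] p.1 * switchPolicy x y p.1 p.2 := by
  have hpow : Tendsto (fun t : ℕ => x * (1 - x - y) ^ t) atTop (𝓝 0) := by
    simpa using (tendsto_pow_atTop_nhds_zero_of_abs_lt_one
      (abs_lt.2 ⟨by linarith, by linarith⟩ : |1 - x - y| < 1)).const_mul x
  refine isOccupation_of_tendsto fun s => ?_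
  simp_rw [markovMatrix_switchPolicy_pow hxy.ne']
  fin_cases s
  · simpa using (hpow.const_add y).div_const (x + y)
  · simpa using (hpow.const_sub x).div_const (x + y)

/-- Feasible occupation measures with reward arbitrarily close to `1 / 2`. -/
lemma exists_mem_occSet_exKernel {x : ℝ} (hx : 0 < x) (hx4 : x ≤ 1 / 4) :
    ∃ q ∈ occSet exKernel (0 : Fin 2),
      q (0, 0) = 1 / 2 ∧ q (1, 1) = (1 - 3 * x) / (2 * (1 - x)) := by
  have h2 : 0 < 1 - x * 2 := by linarith
  have h1 : 0 < 1 - x := by linarith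
  have h2' := h2.ne'
  have hy : 0 < x / (1 - x * 2) := by positivity
  have hy1 : x / (1 - x * 2) ≤ 1 / 2 := by rw [div_le_iff₀ h2]; linarith
  have hsum : x + x / (1 - x * 2) = 2 * x * (1 - x) / (1 - x * 2) := by
    field_simp
    ring
  refine ⟨_, ⟨_, isPolicy_switchPolicy hx.le (by linarith) hy.le (by linarith),
    isOccupation_switchPolicy (by linarith) (by linarith)⟩, ?_, ?_⟩
  · simp only [hsum, switchPolicy, Matrix.cons_val_zero]
    field_simp
  · simp only [hsum, switchPolicy, Matrix.cons_val_one, Matrix.cons_val_fin_one]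
    field_simp
    ring

lemma add_le_one_of_mem_occSet_exKernel {q : Fin 2 × Fin 2 → ℝ}
    (hq : q ∈ occSet exKernel (0 : Fin 2)) : q (0, 0) + q (1, 1) ≤ 1 := by
  obtain ⟨π, hπ, h⟩ := hq
  have hsum := h.sum_eq_one isKernel_exKernel hπ
  have hnn := h.nonneg isKernel_exKernel hπ
  simp only [Fintype.sum_prod_type, Fin.sum_univ_two] at hsum
  linarith [hnn (0, 1), hnn (1, 0)]

/-- Never leaving `s₁` rules out reward, and leaving it forces some mass on `(s₁, a₂)`. -/
lemma add_lt_one_of_mem_occSet_exKernel {q : Fin 2 × Fin 2 → ℝ}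
    (hq : q ∈ occSet exKernel (0 : Fin 2)) (h0 : 0 < q (0, 0)) (h1 : 0 < q (1, 1)) :
    q (0, 0) + q (1, 1) < 1 := by
  refine (add_le_one_of_mem_occSet_exKernel hq).lt_of_ne fun heq => ?_
  obtain ⟨π, hπ, h⟩ := hq
  have hsum := h.sum_eq_one isKernel_exKernel hπ
  have hnn := h.nonneg isKernel_exKernel hπ
  simp only [Fintype.sum_prod_type, Fin.sum_univ_two] at hsum
  have h01 : q (0, 1) = 0 := by linarith [hnn (0, 1), hnn (1, 0)]
  have hπ01 : π 0 1 = 0 := by simpa [h01, h0.ne'] using h.mul_policy_comm 0 0 1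
  have hpow (t : ℕ) : (markovMatrix exKernel π ^ t) 0 1 = 0 := by
    induction t with
    | zero => simp
    | succ t ih =>
      rw [pow_succ, Matrix.mul_apply, Fin.sum_univ_two, ih, markovMatrix_exKernel, hπ01]
      ring
  have h11 : q (1, 1) = 0 :=
    tendsto_nhds_unique (h 1 1) (tendsto_const_nhds.congr fun T => by simp [hpow])
  exact h1.ne' h11

/-- **A weakly communicating average-reward CMDP need not admit an optimal stationary
policy.** For the two-state example with threshold `b = 1/2` and initial state `s₁`:
the MDP is weakly communicating, the constrained supremum equals `1/2`, and no feasible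
occupation measure attains it. -/
theorem no_optimal_stationary_policy :
    WeaklyCommunicating exKernel ∧
    sSup {x | ∃ q ∈ occSet exKernel (0 : Fin 2),
        (1 : ℝ) / 2 ≤ dotSA exConstraint q ∧ x = dotSA exReward q} = 1 / 2 ∧
    ¬ ∃ q ∈ occSet exKernel (0 : Fin 2),
        (1 : ℝ) / 2 ≤ dotSA exConstraint q ∧ dotSA exReward q = 1 / 2 := by
  simp only [dotSA_exReward, dotSA_exConstraint]
  refine ⟨weaklyCommunicating_exKernel, ?_, ?_⟩
  · refine csSup_eq_of_forall_le_of_forall_lt_exists_gt ?_ ?_ ?_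
    · obtain ⟨q, hq, h0, -⟩ := exists_mem_occSet_exKernel (x := 1 / 4) (by norm_num) le_rfl
      exact ⟨_, q, hq, h0.ge, rfl⟩
    · rintro _ ⟨q, hq, h0, rfl⟩
      linarith [add_le_one_of_mem_occSet_exKernel hq]
    · intro w hw
      obtain ⟨x, hx, hxlt⟩ : ∃ x, 0 < x ∧ x < min (1 / 4) ((1 / 2 - w) / 2) :=
        exists_between (lt_min (by norm_num) (by linarith))
      obtain ⟨hx4, hxw⟩ := lt_min_iff.1 hxlt
      obtain ⟨q, hq, h0, h1⟩ := exists_mem_occSet_exKernel hx hx4.le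
      refine ⟨_, ⟨q, hq, h0.ge, rfl⟩, ?_⟩
      rw [h1, lt_div_iff₀ (by linarith)]
      nlinarith
  · rintro ⟨q, hq, h0, h1⟩
    linarith [add_lt_one_of_mem_occSet_exKernel hq (by linarith) (by linarith)]
end
end
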